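/- arXiv:2508.18247 — 2 statements merged into one kernel-verified Lean document; each statement's English description precedes it below -/
import Mathlib

section
/- Let Λ ⊆ ℂ be a lattice, let s ∈ ℂ satisfy ns ∉ Λ for every integer n ≥ 1, let R be a pinning, and let f be an elliptic function for Λ. Then f is elliptically summable if and only if the following three conditions hold: (i) c₀_R(f) = 0; (ii) pano_R(f,1) = Σ_{r∈R} Σ_{n∈ℤ} n·c_1(f, r+ns) = 0; and (iii) for every r ∈ R and every k ≥ 1, ores(f,r,k) = Σ_{n∈ℤ} c_k(f, r+ns) = 0. -/
open Filter Topology Set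

/-- The Weierstrass zeta function of a lattice `L ⊆ ℂ`. -/
noncomputable def wzeta (L : Set ℂ) (z : ℂ) : ℂ :=
  1 / z + ∑' l : ↥(L \ {0}), (1 / (z - (l : ℂ)) + 1 / (l : ℂ) + z / (l : ℂ) ^ 2)

/-- `L` is a lattice in `ℂ`. -/
def IsLattice (L : Set ℂ) : Prop :=
  ∃ ω₁ ω₂ : ℂ, LinearIndependent ℝ ![ω₁, ω₂] ∧
    L = {z : ℂ | ∃ m n : ℤ, z = (m : ℂ) * ω₁ + (n : ℂ) * ω₂}

/-- `F` extends analytically to the point `α`. -/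
def ExtAnalyticAt (F : ℂ → ℂ) (α : ℂ) : Prop :=
  ∃ g : ℂ → ℂ, AnalyticAt ℂ g α ∧ ∀ᶠ z in 𝓝[≠] α, F z = g z

/-- `f` is an elliptic function for the lattice `L`: meromorphic on `ℂ` and `L`-periodic. -/
def IsElliptic (L : Set ℂ) (f : ℂ → ℂ) : Prop :=
  MeromorphicOn f Set.univ ∧
    ∀ lam ∈ L, ∀ z : ℂ, AnalyticAt ℂ f z → f (z + lam) = f z

/-- `c : ℕ → ℂ` is the family of principal part coefficients of `f` at `α`
(`c k` is the coefficient of `1/(z-α)^k`; `c 0` is irrelevant and set to `0`). -/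
def IsPrincPart (f : ℂ → ℂ) (α : ℂ) (c : ℕ → ℂ) : Prop :=
  c 0 = 0 ∧ (Function.support c).Finite ∧
    ExtAnalyticAt (fun z => f z - ∑ᶠ k : ℕ, c k / (z - α) ^ k) α

/-- `R` is a pinning: `(r, n, λ) ↦ r + n s + λ` is a bijection from `R × ℤ × L` onto `ℂ`. -/
def IsPinning (L : Set ℂ) (s : ℂ) (R : Set ℂ) : Prop :=
  ∀ z : ℂ, ∃! p : ℂ × ℤ × ℂ, p.1 ∈ R ∧ p.2.2 ∈ L ∧ z = p.1 + (p.2.1 : ℂ) * s + p.2.2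


/-- `f` is elliptically summable: `f = τ(g) − g` for some elliptic `g`,
where `τ(g)(z) = g(z+s)`. -/
def EllSummable (L : Set ℂ) (s : ℂ) (f : ℂ → ℂ) : Prop :=
  ∃ g : ℂ → ℂ, IsElliptic L g ∧
    ∀ z : ℂ, AnalyticAt ℂ g z → AnalyticAt ℂ g (z + s) → f z = g (z + s) - g z

/-! ### Properties holding off a discrete closed set -/

lemma eventually_codiscrete_iff {p : ℂ → Prop} :
    (∀ᶠ w in codiscrete ℂ, p w) ↔ ∀ z, ∀ᶠ w in 𝓝[≠] z, p w := by
  simp [codiscrete, codiscreteWithin, compl_eq_univ_sdiff]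

lemma tendsto_add_right_nhdsNE (z a : ℂ) :
    Tendsto (fun w => w + a) (𝓝[≠] z) (𝓝[≠] (z + a)) := by
  refine tendsto_nhdsWithin_of_tendsto_nhds_of_eventually_within _ ?_ ?_
  · exact (Continuous.tendsto (by fun_prop) z).mono_left nhdsWithin_le_nhds
  · filter_upwards [self_mem_nhdsWithin] with w hw
    simpa using hw

lemma tendsto_add_right_codiscrete (a : ℂ) :
    Tendsto (fun w => w + a) (codiscrete ℂ) (codiscrete ℂ) := by
  intro s hs
  have h := eventually_codiscrete_iff.1 (show ∀ᶠ w in codiscrete ℂ, w ∈ s from hs)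
  exact eventually_codiscrete_iff.2 fun z => (tendsto_add_right_nhdsNE z a).eventually (h (z + a))

instance : (codiscrete ℂ).NeBot := by
  constructor
  intro h
  have : ∀ᶠ _ in codiscrete ℂ, False := by simp [h]
  exact (eventually_codiscrete_iff.1 this 0).exists.choose_spec

lemma eq_of_continuous_of_eventuallyEq_codiscrete {F G : ℂ → ℂ} (hF : Continuous F)
    (hG : Continuous G) (h : F =ᶠ[codiscrete ℂ] G) : F = G := by
  funext z
  exact tendsto_nhds_unique_of_eventuallyEq (hF.continuousAt.tendsto.mono_left nhdsWithin_le_nhds)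
    (hG.continuousAt.tendsto.mono_left nhdsWithin_le_nhds) (eventually_codiscrete_iff.1 h z)

lemma eventually_analyticAt_codiscrete {f : ℂ → ℂ} (hf : MeromorphicOn f univ) :
    ∀ᶠ z in codiscrete ℂ, AnalyticAt ℂ f z :=
  hf.eventually_codiscreteWithin_analyticAt

/-! ### Analytic extension -/

lemma AnalyticAt.extAnalyticAt {F : ℂ → ℂ} {α : ℂ} (h : AnalyticAt ℂ F α) : ExtAnalyticAt F α :=
  ⟨F, h, by simp⟩

lemma ExtAnalyticAt.congr {F G : ℂ → ℂ} {α : ℂ} (h : ExtAnalyticAt F α) (e : G =ᶠ[𝓝[≠] α] F) :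
    ExtAnalyticAt G α := by
  obtain ⟨g, hg, hFg⟩ := h
  exact ⟨g, hg, e.trans hFg⟩

lemma ExtAnalyticAt.add {F G : ℂ → ℂ} {α : ℂ} (hF : ExtAnalyticAt F α) (hG : ExtAnalyticAt G α) :
    ExtAnalyticAt (fun z => F z + G z) α := by
  obtain ⟨f, hf, hFf⟩ := hF
  obtain ⟨g, hg, hGg⟩ := hG
  refine ⟨fun z => f z + g z, hf.add hg, ?_⟩
  filter_upwards [hFf, hGg] with z h₁ h₂
  rw [h₁, h₂]

lemma ExtAnalyticAt.const_mul {F : ℂ → ℂ} {α : ℂ} (hF : ExtAnalyticAt F α) (a : ℂ) :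
    ExtAnalyticAt (fun z => a * F z) α := by
  obtain ⟨f, hf, hFf⟩ := hF
  refine ⟨fun z => a * f z, analyticAt_const.mul hf, ?_⟩
  filter_upwards [hFf] with z h₁
  rw [h₁]

lemma ExtAnalyticAt.sub {F G : ℂ → ℂ} {α : ℂ} (hF : ExtAnalyticAt F α) (hG : ExtAnalyticAt G α) :
    ExtAnalyticAt (fun z => F z - G z) α :=
  (hF.add (hG.const_mul (-1))).congr (.of_forall fun z => by ring)

lemma ExtAnalyticAt.meromorphicAt {F : ℂ → ℂ} {α : ℂ} (h : ExtAnalyticAt F α) :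
    MeromorphicAt F α := by
  obtain ⟨g, hg, hFg⟩ := h
  exact hg.meromorphicAt.congr (EventuallyEq.symm hFg)

lemma ExtAnalyticAt.comp_add_right {F : ℂ → ℂ} {α t : ℂ} (h : ExtAnalyticAt F (α + t)) :
    ExtAnalyticAt (fun z => F (z + t)) α := by
  obtain ⟨g, hg, hFg⟩ := h
  exact ⟨fun z => g (z + t), hg.comp_of_eq (by fun_prop) rfl,
    (tendsto_add_right_nhdsNE α t).eventually hFg⟩

/-- Removing all singularities at once. -/
lemma exists_differentiable_of_extAnalyticAt {F : ℂ → ℂ} (h : ∀ α, ExtAnalyticAt F α) :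
    ∃ H : ℂ → ℂ, Differentiable ℂ H ∧ F =ᶠ[codiscrete ℂ] H := by
  choose g hg hFg using h
  have key (α : ℂ) : (fun z => g z z) =ᶠ[𝓝 α] g α := by
    have h₁ : ∀ᶠ z in 𝓝[≠] α, ∀ᶠ w in 𝓝[≠] z, F w = g α w := by
      filter_upwards [eventually_eventually_nhdsWithin.2 (hFg α), self_mem_nhdsWithin] with z hz hne
      have hne' : {α}ᶜ ∈ 𝓝 z := isOpen_compl_singleton.mem_nhds hne
      rw [nhdsWithin_eq_nhds.2 hne'] at hz
      exact hz.filter_mono nhdsWithin_le_nhds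
    have h₂ : ∀ᶠ z in 𝓝[≠] α, g z z = g α z := by
      filter_upwards [h₁, (hg α).eventually_analyticAt.filter_mono nhdsWithin_le_nhds] with z hz hgz
      refine tendsto_nhds_unique_of_eventuallyEq (l := 𝓝[≠] z)
        ((hg z).continuousAt.tendsto.mono_left nhdsWithin_le_nhds)
        (hgz.continuousAt.tendsto.mono_left nhdsWithin_le_nhds) ?_
      filter_upwards [hz, hFg z] with w h₁ h₂
      rw [← h₁, ← h₂]
    rw [EventuallyEq, ← nhdsNE_sup_pure, eventually_sup]
    exact ⟨h₂, by simp⟩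
  refine ⟨fun z => g z z, fun α => ((hg α).congr (key α).symm).differentiableAt, ?_⟩
  refine eventually_codiscrete_iff.2 fun z => ?_
  filter_upwards [hFg z, (key z).filter_mono nhdsWithin_le_nhds] with w h₁ h₂
  rw [h₁, h₂]

/-- Liouville's theorem for elliptic functions without poles. -/
lemma Differentiable.eq_const_of_periodic (P : PeriodPair) {H : ℂ → ℂ} (hH : Differentiable ℂ H)
    (hper : ∀ z, ∀ l ∈ P.lattice, H (z + l) = H z) (z w : ℂ) : H z = H w :=
  hH.apply_eq_apply_of_bounded
    (IsZLattice.isCompact_range_of_periodic P.lattice H hH.continuous hper).isBounded z w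

lemma exists_eventuallyEq_const (P : PeriodPair) {F : ℂ → ℂ} (h : ∀ α, ExtAnalyticAt F α)
    (hper : ∀ l ∈ P.lattice, ∀ᶠ z in codiscrete ℂ, F (z + l) = F z) :
    ∃ b, ∀ᶠ z in codiscrete ℂ, F z = b := by
  obtain ⟨H, hH, hFH⟩ := exists_differentiable_of_extAnalyticAt h
  refine ⟨H 0, ?_⟩
  filter_upwards [hFH] with z hz
  rw [hz]
  refine hH.eq_const_of_periodic P (fun z l hl => ?_) z 0
  refine congrFun (eq_of_continuous_of_eventuallyEq_codiscrete (F := fun z => H (z + l))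
    (hH.continuous.comp (by fun_prop)) hH.continuous ?_) z
  filter_upwards [hper l hl, hFH, (tendsto_add_right_codiscrete l).eventually hFH] with w h₁ h₂ h₃
  rw [← h₂, ← h₃, h₁]

/-! ### Principal parts -/

/-- The Laurent tail `∑ₖ cₖ / (z - α) ^ (k + 1)`, as a function of `z`. -/
noncomputable def laurentTail (α : ℂ) : (ℕ →₀ ℂ) →ₗ[ℂ] (ℂ → ℂ) :=
  Finsupp.linearCombination ℂ fun k z => 1 / (z - α) ^ (k + 1)

lemma laurentTail_apply (α : ℂ) (c : ℕ →₀ ℂ) (z : ℂ) :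
    laurentTail α c z = c.sum fun k a => a * (1 / (z - α) ^ (k + 1)) := by
  simp [laurentTail, Finsupp.linearCombination_apply, Finsupp.sum, Finset.sum_apply]

@[simp] lemma laurentTail_single (α : ℂ) (k : ℕ) (a z : ℂ) :
    laurentTail α (Finsupp.single k a) z = a * (1 / (z - α) ^ (k + 1)) := by
  simp [laurentTail]

lemma laurentTail_add_right (α t : ℂ) (c : ℕ →₀ ℂ) (z : ℂ) :
    laurentTail (α + t) c (z + t) = laurentTail α c z := by
  simp [laurentTail_apply]

/-- `c` is the principal part of `f` at `α`; the coefficient of `1 / (z - α) ^ (k + 1)` is `c k`. -/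
def HasPrincPart (f : ℂ → ℂ) (α : ℂ) (c : ℕ →₀ ℂ) : Prop :=
  ExtAnalyticAt (fun z => f z - laurentTail α c z) α

lemma HasPrincPart.congr {f g : ℂ → ℂ} {α : ℂ} {c : ℕ →₀ ℂ} (h : HasPrincPart f α c)
    (e : g =ᶠ[𝓝[≠] α] f) : HasPrincPart g α c := by
  refine ExtAnalyticAt.congr h ?_
  filter_upwards [e] with z hz
  rw [hz]

lemma HasPrincPart.comp_add_right {f : ℂ → ℂ} {α t : ℂ} {c : ℕ →₀ ℂ}
    (h : HasPrincPart f (α + t) c) : HasPrincPart (fun z => f (z + t)) α c := by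
  simpa only [laurentTail_add_right] using! ExtAnalyticAt.comp_add_right h

lemma HasPrincPart.add {f g : ℂ → ℂ} {α : ℂ} {c d : ℕ →₀ ℂ} (hf : HasPrincPart f α c)
    (hg : HasPrincPart g α d) : HasPrincPart (fun z => f z + g z) α (c + d) := by
  refine (ExtAnalyticAt.add hf hg).congr (.of_forall fun z => ?_)
  simp only [map_add, Pi.add_apply]
  ring

lemma HasPrincPart.const_mul {f : ℂ → ℂ} {α : ℂ} {c : ℕ →₀ ℂ} (hf : HasPrincPart f α c) (a : ℂ) :
    HasPrincPart (fun z => a * f z) α (a • c) := by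
  refine (ExtAnalyticAt.const_mul hf a).congr (.of_forall fun z => ?_)
  simp only [map_smul, Pi.smul_apply, smul_eq_mul]
  ring

lemma AnalyticAt.hasPrincPart {f : ℂ → ℂ} {α : ℂ} (hf : AnalyticAt ℂ f α) :
    HasPrincPart f α 0 := by
  simpa [HasPrincPart] using hf.extAnalyticAt

lemma HasPrincPart.unique {f : ℂ → ℂ} {α : ℂ} {c d : ℕ →₀ ℂ} (hc : HasPrincPart f α c)
    (hd : HasPrincPart f α d) : c = d := by
  suffices ∀ e : ℕ →₀ ℂ, ExtAnalyticAt (laurentTail α e) α → e = 0 by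
    refine sub_eq_zero.1 (this _ ((ExtAnalyticAt.sub hd hc).congr (.of_forall fun z => ?_)))
    simp only [map_sub, Pi.sub_apply]
    ring
  rintro e ⟨g, hg, heg⟩
  by_contra hne
  obtain ⟨N, hN, hmax⟩ := e.support.exists_max_image id (Finsupp.support_nonempty_iff.2 hne)
  refine (Finsupp.mem_support_iff.1 hN) ?_
  have h0 : Tendsto (fun z : ℂ => z - α) (𝓝[≠] α) (𝓝 0) :=
    ((continuous_id.sub continuous_const).tendsto' α 0 (by simp)).mono_left nhdsWithin_le_nhds
  have h₁ : Tendsto (fun z => (z - α) ^ (N + 1) * laurentTail α e z) (𝓝[≠] α) (𝓝 (e N)) := by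
    have : e N = ∑ k ∈ e.support, (0 : ℂ) ^ (N - k) * e k := by
      rw [Finset.sum_eq_single_of_mem N hN]
      · simp
      · intro k hk hkN
        have := hmax k hk
        simp only [id] at this
        rw [zero_pow (by omega), zero_mul]
    rw [this]
    refine Tendsto.congr' (f₁ := fun z => ∑ k ∈ e.support, (z - α) ^ (N - k) * e k) ?_
      (tendsto_finsetSum _ fun k _ => (h0.pow _).mul_const _)
    filter_upwards [self_mem_nhdsWithin] with z hz
    have hz' : z - α ≠ 0 := sub_ne_zero.2 hz
    rw [laurentTail_apply, Finsupp.sum, Finset.mul_sum]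
    refine Finset.sum_congr rfl fun k hk => ?_
    have := hmax k hk
    simp only [id] at this
    obtain ⟨m, rfl⟩ := Nat.exists_eq_add_of_le this
    rw [Nat.add_sub_cancel_left, show k + m + 1 = m + (k + 1) by ring, pow_add]
    field_simp
  have h₂ : Tendsto (fun z => (z - α) ^ (N + 1) * laurentTail α e z) (𝓝[≠] α) (𝓝 0) := by
    have : Tendsto (fun z => (z - α) ^ (N + 1) * g z) (𝓝[≠] α) (𝓝 (0 ^ (N + 1) * g α)) :=
      (h0.pow _).mul (hg.continuousAt.tendsto.mono_left nhdsWithin_le_nhds)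
    simp only [ne_eq, Nat.add_eq_zero_iff, one_ne_zero, and_false, not_false_eq_true, zero_pow,
      zero_mul] at this
    refine this.congr' ?_
    filter_upwards [heg] with z hz
    rw [hz]
  exact tendsto_nhds_unique h₁ h₂

lemma exists_hasPrincPart_div_pow {F : ℂ → ℂ} {α : ℂ} (hF : AnalyticAt ℂ F α) (n : ℕ) :
    ∃ c, HasPrincPart (fun z => F z / (z - α) ^ n) α c := by
  induction n generalizing F with
  | zero => exact ⟨0, by simpa using hF.hasPrincPart⟩
  | succ n ih =>
    have hG : AnalyticAt ℂ (dslope F α) α := by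
      obtain ⟨p, hp⟩ := hF
      exact ⟨_, hp.has_fpower_series_dslope_fslope⟩
    obtain ⟨c, hc⟩ := ih hG
    refine ⟨c + Finsupp.single n (F α), ?_⟩
    refine ExtAnalyticAt.congr hc ?_
    filter_upwards [self_mem_nhdsWithin] with z hz
    have hz' : z - α ≠ 0 := sub_ne_zero.2 hz
    rw [map_add, Pi.add_apply, laurentTail_single, dslope_of_ne _ hz, slope_def_field]
    field_simp
    ring

lemma MeromorphicAt.exists_hasPrincPart {f : ℂ → ℂ} {α : ℂ} (hf : MeromorphicAt f α) :
    ∃ c, HasPrincPart f α c := by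
  obtain ⟨n, hn⟩ := hf
  obtain ⟨c, hc⟩ := exists_hasPrincPart_div_pow hn n
  refine ⟨c, hc.congr ?_⟩
  filter_upwards [self_mem_nhdsWithin] with z hz
  have hz' : z - α ≠ 0 := sub_ne_zero.2 hz
  simp only [smul_eq_mul]
  field_simp

lemma finsum_nat_eq_finsum_succ {F : ℕ → ℂ} (h : F 0 = 0) : ∑ᶠ k, F k = ∑ᶠ k, F (k + 1) := by
  rw [← finsum_mem_range (f := F) (Nat.succ_injective), ← finsum_mem_univ]
  refine finsum_mem_inter_support_eq' _ _ _ fun k hk => ?_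
  cases k with
  | zero => exact absurd h hk
  | succ k => simp

lemma IsPrincPart.hasPrincPart {f : ℂ → ℂ} {α : ℂ} {c : ℕ → ℂ} (h : IsPrincPart f α c) :
    ∃ d : ℕ →₀ ℂ, (∀ k, d k = c (k + 1)) ∧ HasPrincPart f α d := by
  obtain ⟨h0, hfin, hext⟩ := h
  obtain ⟨d, hd⟩ : ∃ d : ℕ →₀ ℂ, ∀ k, d k = c (k + 1) :=
    ⟨Finsupp.ofSupportFinite (fun k => c (k + 1))
      (hfin.preimage (f := fun k => k + 1) (fun a _ b _ hab => by simpa using hab)), fun k => rfl⟩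
  refine ⟨d, hd, hext.congr (.of_forall fun z => ?_)⟩
  simp only
  rw [finsum_nat_eq_finsum_succ (by simp [h0]), laurentTail_apply, Finsupp.sum,
    finsum_eq_sum_of_support_subset (s := d.support)]
  · simp [hd, div_eq_mul_inv]
  · intro k hk
    simp only [Function.mem_support, ne_eq, div_eq_zero_iff, not_or] at hk
    simpa [hd] using hk.1

/-! ### The Weierstrass zeta function -/

namespace PeriodPair

variable (P : PeriodPair)

/-- The Weierstrass zeta function with the `l₀`-term missing. -/
noncomputable def zetaExcept (l₀ z : ℂ) : ℂ :=
  ∑' l : P.lattice, if l.1 = l₀ then 0 else (1 / (z - l) + 1 / (l : ℂ) + z / (l : ℂ) ^ 2)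

lemma zeta_bound (r : ℝ) (hr : 0 < r) (z : ℂ) (hz : ‖z‖ < r) (l : ℂ) (h : 2 * r ≤ ‖l‖) :
    ‖1 / (z - l) + 1 / l + z / l ^ 2‖ ≤ 2 * r ^ 2 * ‖l‖ ^ (-3 : ℝ) := by
  have hzl : ‖l‖ / 2 ≤ ‖z - l‖ := by
    rw [norm_sub_rev]
    exact .trans (by linarith) (norm_sub_norm_le l z)
  have hl : 0 < ‖l‖ := by linarith
  have hl0 : l ≠ 0 := norm_pos_iff.1 hl
  have hzl0 : z - l ≠ 0 := norm_pos_iff.1 (by linarith)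
  calc
    _ = ‖z ^ 2 / ((z - l) * l ^ 2)‖ := by
      congr 1
      field_simp
      ring
    _ = ‖z‖ ^ 2 / (‖z - l‖ * ‖l‖ ^ 2) := by simp
    _ ≤ r ^ 2 / (‖l‖ / 2 * ‖l‖ ^ 2) := by gcongr
    _ = 2 * r ^ 2 / ‖l‖ ^ 3 := by field
    _ = _ := by norm_cast

lemma hasSumLocallyUniformly_zetaExcept (l₀ : ℂ) :
    HasSumLocallyUniformly
      (fun (l : P.lattice) (z : ℂ) =>
        if l.1 = l₀ then 0 else (1 / (z - l) + 1 / (l : ℂ) + z / (l : ℂ) ^ 2))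
      (P.zetaExcept l₀) := by
  refine P.hasSumLocallyUniformly_aux (u := (2 * · ^ 2 * ‖·‖ ^ (-3 : ℝ))) _
    (fun _ _ => (ZLattice.summable_norm_rpow _ _ (by simp; norm_num)).mul_left _) fun r hr =>
    Filter.eventually_atTop.mpr ⟨2 * r, ?_⟩
  rintro _ h z hz l rfl
  split_ifs
  · simpa using! show 0 ≤ 2 * r ^ 2 * (‖(l : ℂ)‖ ^ 3)⁻¹ by positivity
  · exact zeta_bound r hr z hz l h

lemma summable_zetaExcept (l₀ z : ℂ) :
    Summable (fun l : P.lattice =>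
      if l.1 = l₀ then 0 else (1 / (z - l) + 1 / (l : ℂ) + z / (l : ℂ) ^ 2)) :=
  ((P.hasSumLocallyUniformly_zetaExcept l₀).hasSum (x := z)).summable

lemma sub_ne_zero_of_mem_compl {l₀ z : ℂ} (hz : z ∈ ((P.lattice : Set ℂ) \ {l₀})ᶜ)
    (l : P.lattice) (hl : l.1 ≠ l₀) : z - l ≠ 0 := by
  rintro h
  obtain rfl := sub_eq_zero.1 h
  simp_all

lemma hasDerivAt_zeta_term (l : P.lattice) {z : ℂ} (hz : z - l ≠ 0) :
    HasDerivAt (fun z : ℂ => 1 / (z - l) + 1 / (l : ℂ) + z / (l : ℂ) ^ 2)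
      (-(1 / (z - l) ^ 2 - 1 / (l : ℂ) ^ 2)) z := by
  have h₁ : HasDerivAt (fun z : ℂ => 1 / (z - l)) (-1 / (z - l) ^ 2) z := by
    simpa using ((hasDerivAt_id z).sub_const (l : ℂ)).fun_inv hz
  refine ((h₁.add_const (1 / (l : ℂ))).fun_add
    ((hasDerivAt_id z).div_const ((l : ℂ) ^ 2))).congr_deriv ?_
  ring

lemma differentiableOn_zetaExcept (l₀ : ℂ) :
    DifferentiableOn ℂ (P.zetaExcept l₀) ((P.lattice : Set ℂ) \ {l₀})ᶜ := by
  refine (P.hasSumLocallyUniformly_zetaExcept l₀).hasSumLocallyUniformlyOn.differentiableOn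
    (.of_forall fun s => .fun_sum fun l _ => ?_) P.isOpen_compl_lattice_sdiff
  split_ifs with h
  · simp
  · exact fun z hz => (P.hasDerivAt_zeta_term l
      (P.sub_ne_zero_of_mem_compl hz l h)).differentiableAt.differentiableWithinAt

lemma analyticAt_zetaExcept {l₀ z : ℂ} (hz : z ∈ ((P.lattice : Set ℂ) \ {l₀})ᶜ) :
    AnalyticAt ℂ (P.zetaExcept l₀) z :=
  (P.differentiableOn_zetaExcept l₀).analyticAt (P.isOpen_compl_lattice_sdiff.mem_nhds hz)

lemma deriv_zetaExcept (l₀ : ℂ) :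
    Set.EqOn (deriv (P.zetaExcept l₀)) (fun z => -P.weierstrassPExcept l₀ z)
      ((P.lattice : Set ℂ) \ {l₀})ᶜ := by
  refine ((P.hasSumLocallyUniformly_zetaExcept l₀).tendstoLocallyUniformlyOn.deriv
    (.of_forall fun s => .fun_sum fun l _ => ?_) P.isOpen_compl_lattice_sdiff).unique ?_
  · split_ifs with h
    · simp
    · exact fun z hz => (P.hasDerivAt_zeta_term l
        (P.sub_ne_zero_of_mem_compl hz l h)).differentiableAt.differentiableWithinAt
  · have := (P.hasSumLocallyUniformly_weierstrassPExcept l₀).tendstoLocallyUniformlyOn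
      (s := ((P.lattice : Set ℂ) \ {l₀})ᶜ)
    refine (this.neg).congr ?_
    intro s z hz
    simp only [Function.comp_apply, Pi.neg_apply]
    symm
    rw [← Finset.sum_neg_distrib]
    refine HasDerivAt.deriv (HasDerivAt.fun_sum fun l _ => ?_)
    split_ifs with h
    · simpa using hasDerivAt_const z (0 : ℂ)
    · exact P.hasDerivAt_zeta_term l (P.sub_ne_zero_of_mem_compl hz l h)

lemma summable_zeta (z : ℂ) :
    Summable (fun l : P.lattice => 1 / (z - l) + 1 / (l : ℂ) + z / (l : ℂ) ^ 2) := by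
  convert P.summable_zetaExcept (P.ω₁ / 2) z using 2 with l
  rw [if_neg]
  exact fun e => P.ω₁_div_two_notMem_lattice (e ▸ l.2)

lemma tsum_zeta_eq_zetaExcept_add (l₀ : P.lattice) (z : ℂ) :
    ∑' l : P.lattice, (1 / (z - l) + 1 / (l : ℂ) + z / (l : ℂ) ^ 2) =
      P.zetaExcept l₀ z + (1 / (z - l₀) + 1 / (l₀ : ℂ) + z / (l₀ : ℂ) ^ 2) := by
  rw [(P.summable_zeta z).tsum_eq_add_tsum_ite l₀, add_comm, zetaExcept]
  simp only [Subtype.ext_iff]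

lemma wzeta_eq_tsum (z : ℂ) :
    wzeta P.lattice z = ∑' l : P.lattice, (1 / (z - l) + 1 / (l : ℂ) + z / (l : ℂ) ^ 2) := by
  have h := P.tsum_zeta_eq_zetaExcept_add 0 z
  have h0 : 1 / (z - ((0 : P.lattice) : ℂ)) + 1 / ((0 : P.lattice) : ℂ) +
      z / ((0 : P.lattice) : ℂ) ^ 2 = 1 / z := by
    rw [Submodule.coe_zero]
    simp
  rw [h, h0, wzeta, add_comm, zetaExcept]
  congr 1
  rw [tsum_subtype ((P.lattice : Set ℂ) \ {0})
      (fun l : ℂ => 1 / (z - l) + 1 / (l : ℂ) + z / (l : ℂ) ^ 2)]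
  refine .trans ?_ (tsum_subtype (P.lattice : Set ℂ)
      (fun l : ℂ => if l = 0 then 0 else 1 / (z - l) + 1 / (l : ℂ) + z / (l : ℂ) ^ 2)).symm
  congr 1
  funext l
  by_cases h0 : l = 0 <;> by_cases hl : l ∈ P.lattice <;> simp [h0, hl]

lemma wzeta_eq_zetaExcept_add {l₀ : ℂ} (hl₀ : l₀ ∈ P.lattice) (z : ℂ) :
    wzeta P.lattice z = P.zetaExcept l₀ z + (1 / (z - l₀) + 1 / l₀ + z / l₀ ^ 2) := by
  rw [wzeta_eq_tsum, P.tsum_zeta_eq_zetaExcept_add ⟨l₀, hl₀⟩]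

lemma wzeta_eq_zetaExcept {l₀ : ℂ} (hl₀ : l₀ ∉ P.lattice) :
    wzeta P.lattice = P.zetaExcept l₀ := by
  funext z
  rw [wzeta_eq_tsum, zetaExcept]
  congr! 2 with l
  rw [if_neg]
  rintro rfl
  exact hl₀ l.2

lemma isOpen_compl_lattice : IsOpen (P.lattice : Set ℂ)ᶜ :=
  P.isClosed_lattice.isOpen_compl

lemma analyticAt_wzeta {z : ℂ} (hz : z ∉ P.lattice) : AnalyticAt ℂ (wzeta P.lattice) z := by
  rw [P.wzeta_eq_zetaExcept P.ω₁_div_two_notMem_lattice]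
  exact P.analyticAt_zetaExcept fun h => hz h.1

lemma deriv_wzeta {z : ℂ} (hz : z ∉ P.lattice) :
    deriv (wzeta P.lattice) z = -P.weierstrassP z := by
  rw [P.wzeta_eq_zetaExcept P.ω₁_div_two_notMem_lattice,
    P.deriv_zetaExcept _ (fun h => hz h.1),
    P.weierstrassPExcept_of_notMem _ P.ω₁_div_two_notMem_lattice]

lemma exists_wzeta_eq_add {l : ℂ} (hl : l ∈ P.lattice) :
    ∃ h : ℂ → ℂ, AnalyticAt ℂ h l ∧ ∀ z, wzeta P.lattice z = 1 / (z - l) + h z := by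
  refine ⟨fun z => P.zetaExcept l z + (1 / l + z / l ^ 2), ?_, fun z => ?_⟩
  · refine (P.analyticAt_zetaExcept (by simp)).add (analyticAt_const.add ?_)
    simp only [div_eq_mul_inv]
    exact analyticAt_id.mul analyticAt_const
  · rw [P.wzeta_eq_zetaExcept_add hl]
    ring

lemma countable_lattice : (P.lattice : Set ℂ).Countable :=
  Set.countable_coe_iff.1 P.latticeEquivProd.injective.countable

lemma isPreconnected_compl_lattice : IsPreconnected (P.lattice : Set ℂ)ᶜ :=
  (P.countable_lattice.isConnected_compl_of_one_lt_rank (by simp)).isPreconnected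

lemma add_notMem_lattice {l z : ℂ} (hl : l ∈ P.lattice) (hz : z ∉ P.lattice) :
    z + l ∉ P.lattice :=
  fun h => hz ((add_mem_cancel_right hl).1 h)

lemma exists_wzeta_add_eq {l : ℂ} (hl : l ∈ P.lattice) :
    ∃ η : ℂ, ∀ z, z ∉ P.lattice → wzeta P.lattice (z + l) = wzeta P.lattice z + η := by
  have hder : ∀ z ∈ (P.lattice : Set ℂ)ᶜ,
      HasDerivAt (fun z => wzeta P.lattice (z + l) - wzeta P.lattice z) 0 z := by
    intro z hz
    have h₁ := (P.analyticAt_wzeta hz).differentiableAt.hasDerivAt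
    have hz' := P.add_notMem_lattice hl hz
    have h₂ := (P.analyticAt_wzeta hz').differentiableAt.hasDerivAt.comp_add_const z l
    refine (h₂.fun_sub h₁).congr_deriv ?_
    rw [P.deriv_wzeta hz, P.deriv_wzeta hz', P.weierstrassP_add_coe z ⟨l, hl⟩, sub_self]
  refine ⟨wzeta P.lattice (P.ω₁ / 2 + l) - wzeta P.lattice (P.ω₁ / 2), fun z hz => ?_⟩
  have := P.isOpen_compl_lattice.is_const_of_deriv_eq_zero P.isPreconnected_compl_lattice
    (fun z hz => (hder z hz).differentiableAt.differentiableWithinAt)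
    (fun z hz => (hder z hz).deriv) hz (y := P.ω₁ / 2) P.ω₁_div_two_notMem_lattice
  rw [← this]
  ring

/-- The derivative of the Weierstrass zeta function normalised to have principal part
`1 / (z - l) ^ (k + 1)` at the lattice points `l`. -/
noncomputable def zetaPart (k : ℕ) (z : ℂ) : ℂ :=
  (-1) ^ k / (k.factorial : ℂ) * iteratedDeriv k (wzeta P.lattice) z

lemma zetaPart_zero (z : ℂ) : P.zetaPart 0 z = wzeta P.lattice z := by
  simp [zetaPart]

lemma analyticAt_zetaPart (k : ℕ) {z : ℂ} (hz : z ∉ P.lattice) :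
    AnalyticAt ℂ (P.zetaPart k) z := by
  unfold zetaPart
  rw [iteratedDeriv_eq_iterate]
  exact analyticAt_const.mul ((P.analyticAt_wzeta hz).iterated_deriv k)

lemma exists_iteratedDeriv_wzeta_eq (k : ℕ) {l : ℂ} (hl : l ∈ P.lattice) :
    ∃ h : ℂ → ℂ, AnalyticAt ℂ h l ∧ ∀ᶠ z in 𝓝[≠] l, iteratedDeriv k (wzeta P.lattice) z =
      (-1) ^ k * (k.factorial : ℂ) * ((z - l) ^ (k + 1))⁻¹ + h z := by
  induction k with
  | zero =>
    obtain ⟨h, hh, he⟩ := P.exists_wzeta_eq_add hl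
    exact ⟨h, hh, .of_forall fun z => by simp [he z]⟩
  | succ k ih =>
    obtain ⟨h, hh, he⟩ := ih
    refine ⟨deriv h, hh.deriv, ?_⟩
    filter_upwards [EventuallyEq.nhdsNE_deriv he, self_mem_nhdsWithin,
      hh.eventually_analyticAt.filter_mono nhdsWithin_le_nhds] with z h₁ hz h₂
    have hz' : z - l ≠ 0 := sub_ne_zero.2 hz
    have hinv : HasDerivAt (fun z : ℂ => ((z - l) ^ (k + 1))⁻¹)
        (-((k + 1 : ℕ) * (z - l) ^ k * 1) / ((z - l) ^ (k + 1)) ^ 2) z :=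
      (((hasDerivAt_id z).sub_const l).fun_pow (k + 1)).fun_inv (pow_ne_zero _ hz')
    rw [iteratedDeriv_succ, h₁, ((hinv.const_mul _).fun_add h₂.differentiableAt.hasDerivAt).deriv,
      Nat.factorial_succ]
    congr 1
    push_cast
    field_simp
    ring

lemma hasPrincPart_zetaPart (k : ℕ) {l : ℂ} (hl : l ∈ P.lattice) :
    HasPrincPart (P.zetaPart k) l (Finsupp.single k 1) := by
  obtain ⟨h, hh, he⟩ := P.exists_iteratedDeriv_wzeta_eq k hl
  refine ⟨fun z => (-1) ^ k / (k.factorial : ℂ) * h z, analyticAt_const.mul hh, ?_⟩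
  filter_upwards [he] with z hz
  have hk : (k.factorial : ℂ) ≠ 0 := by exact_mod_cast k.factorial_ne_zero
  have hsq : ((-1 : ℂ) ^ k) * (-1) ^ k = 1 := by rw [← mul_pow]; simp
  rw [zetaPart, hz, laurentTail_single]
  field_simp
  linear_combination (k.factorial : ℂ) * ((z - l) ^ (k + 1))⁻¹ * hsq

lemma exists_zetaPart_add_eq {l : ℂ} (hl : l ∈ P.lattice) :
    ∃ η : ℂ, ∀ k, ∀ z ∉ P.lattice,
      P.zetaPart k (z + l) = P.zetaPart k z + if k = 0 then η else 0 := by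
  obtain ⟨η, hη⟩ := P.exists_wzeta_add_eq hl
  have key (k : ℕ) : ∀ z ∉ P.lattice, iteratedDeriv k (wzeta P.lattice) (z + l) =
      iteratedDeriv k (wzeta P.lattice) z + if k = 0 then η else 0 := by
    induction k with
    | zero => simpa using hη
    | succ k ih =>
      intro z hz
      have := (EventuallyEq.deriv_eq (f₁ := fun z => iteratedDeriv k (wzeta P.lattice) (z + l))
        (by filter_upwards [P.isOpen_compl_lattice.mem_nhds hz] with w hw using ih w hw))
      rw [deriv_comp_add_const, deriv_add_const] at this
      simpa [iteratedDeriv_succ] using this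
  refine ⟨η, fun k z hz => ?_⟩
  rw [zetaPart, key k z hz, zetaPart]
  cases k <;> simp

lemma eventually_notMem_lattice (z : ℂ) : ∀ᶠ w in 𝓝[≠] z, w ∉ P.lattice := by
  filter_upwards [nhdsWithin_le_nhds (P.compl_lattice_sdiff_singleton_mem_nhds z),
    self_mem_nhdsWithin] with w hw hne h
  exact hw ⟨h, hne⟩

lemma eventually_notMem_lattice_codiscrete : ∀ᶠ w in codiscrete ℂ, w ∉ P.lattice :=
  eventually_codiscrete_iff.2 P.eventually_notMem_lattice

/-- A function that is periodic off the lattice extends to a lattice point if it extends to `0`. -/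
lemma extAnalyticAt_of_periodic {F : ℂ → ℂ} (h₀ : ExtAnalyticAt F 0)
    (hper : ∀ l ∈ P.lattice, ∀ z ∉ P.lattice, F (z + l) = F z) {l : ℂ} (hl : l ∈ P.lattice) :
    ExtAnalyticAt F l := by
  have h₁ : ExtAnalyticAt (fun z => F (z + -l)) l :=
    ExtAnalyticAt.comp_add_right (by simpa using h₀)
  refine h₁.congr ?_
  filter_upwards [P.eventually_notMem_lattice l] with z hz
  exact (hper (-l) (neg_mem hl) z hz).symm

lemma exists_eqOn_const {F : ℂ → ℂ} (hF : ∀ z ∉ P.lattice, AnalyticAt ℂ F z)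
    (h₀ : ExtAnalyticAt F 0) (hper : ∀ l ∈ P.lattice, ∀ z ∉ P.lattice, F (z + l) = F z) :
    ∃ b, ∀ z ∉ P.lattice, F z = b := by
  obtain ⟨b, hb⟩ := exists_eventuallyEq_const P (F := F)
    (fun α => (em (α ∈ P.lattice)).elim (P.extAnalyticAt_of_periodic h₀ hper)
      fun hα => (hF α hα).extAnalyticAt)
    (fun l hl => P.eventually_notMem_lattice_codiscrete.mono (hper l hl))
  exact ⟨b, fun z hz => tendsto_nhds_unique_of_eventuallyEq (l := 𝓝[≠] z)
    ((hF z hz).continuousAt.tendsto.mono_left nhdsWithin_le_nhds) tendsto_const_nhds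
    (eventually_codiscrete_iff.1 hb z)⟩

lemma not_eventually_inv_add_eq {h : ℂ → ℂ} (hh : AnalyticAt ℂ h 0) (c : ℂ) :
    ¬ ∀ᶠ z in 𝓝[≠] (0 : ℂ), 1 / z + h z = c := by
  intro H
  have : Tendsto (fun z => z * (c - h z)) (𝓝[≠] 0) (𝓝 (0 * (c - h 0))) :=
    ((continuousAt_id.mul (continuousAt_const.sub hh.continuousAt)).tendsto).mono_left
      nhdsWithin_le_nhds
  rw [zero_mul] at this
  refine one_ne_zero (tendsto_nhds_unique_of_eventuallyEq (l := 𝓝[≠] (0 : ℂ))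
    (f := fun _ => (1 : ℂ)) tendsto_const_nhds this ?_)
  filter_upwards [H, self_mem_nhdsWithin] with z hz (hne : z ≠ 0)
  rw [← hz]
  field_simp
  ring

/-- A solution of `φ' = c² - φ²` with a pole at `0` does not take the value `c`. -/
lemma ne_of_riccati {φ h : ℂ → ℂ} (hφ : ∀ z ∉ P.lattice, AnalyticAt ℂ φ z)
    (hh : AnalyticAt ℂ h 0) (hφh : ∀ᶠ z in 𝓝[≠] 0, φ z = 1 / z + h z) {c : ℂ}
    (hric : ∀ z ∉ P.lattice, φ z ^ 2 + deriv φ z = c ^ 2) {z : ℂ} (hz : z ∉ P.lattice) :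
    φ z ≠ c := by
  intro hzc
  set u : ℂ → ℂ := fun w => φ w - φ z with hu
  have hua : AnalyticAt ℂ u z := (hφ z hz).sub analyticAt_const
  have hd : deriv φ =ᶠ[𝓝 z] u * fun w => -(φ w + c) := by
    filter_upwards [P.isOpen_compl_lattice.mem_nhds hz] with w hw
    simp only [hu, Pi.mul_apply, hzc]
    linear_combination hric w hw
  have hord := (hφ z hz).analyticOrderAt_deriv_add_one
  rw [analyticOrderAt_congr hd,
    analyticOrderAt_mul hua ((hφ z hz).fun_add analyticAt_const).fun_neg] at hord
  have htop : analyticOrderAt u z = ⊤ := by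
    by_contra hne
    obtain ⟨n, hn⟩ := ENat.ne_top_iff_exists.1 hne
    change _ = analyticOrderAt u z at hord
    rw [← hn] at hord
    have : (n : ℕ∞) + 1 ≤ n := by
      conv_rhs => rw [← hord]
      gcongr
      exact le_self_add
    exact absurd this (by exact_mod_cast Nat.not_succ_le_self n)
  have hev : u =ᶠ[𝓝 z] 0 := analyticOrderAt_eq_top.1 htop
  have huL := AnalyticOnNhd.eqOn_zero_of_preconnected_of_eventuallyEq_zero
    (U := (P.lattice : Set ℂ)ᶜ) (f := u) (fun w hw => (hφ w hw).sub analyticAt_const)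
    P.isPreconnected_compl_lattice hz hev
  refine not_eventually_inv_add_eq hh (φ z) ?_
  filter_upwards [hφh, P.eventually_notMem_lattice 0] with w h₁ h₂
  rw [← h₁]
  exact sub_eq_zero.1 (huL h₂)

lemma extAnalyticAt_sq_add_deriv {φ h : ℂ → ℂ} (hh : AnalyticAt ℂ h 0) (h0 : h 0 = 0)
    (hφh : ∀ᶠ z in 𝓝[≠] 0, φ z = 1 / z + h z) :
    ExtAnalyticAt (fun z => φ z ^ 2 + deriv φ z) 0 := by
  obtain ⟨k, hk, hkh⟩ : ∃ k : ℂ → ℂ, AnalyticAt ℂ k 0 ∧ ∀ z ≠ 0, h z = z * k z := by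
    refine ⟨dslope h 0, ?_, fun z hz => ?_⟩
    · obtain ⟨p, hp⟩ := hh
      exact ⟨_, hp.has_fpower_series_dslope_fslope⟩
    · rw [dslope_of_ne _ hz, slope_def_field, h0]
      field_simp
      ring
  refine ⟨fun z => 2 * k z + h z ^ 2 + deriv h z, by fun_prop, ?_⟩
  filter_upwards [hφh, EventuallyEq.nhdsNE_deriv hφh, self_mem_nhdsWithin,
    hh.eventually_analyticAt.filter_mono nhdsWithin_le_nhds] with z h₁ h₂ (hz : z ≠ 0) h₃
  have hinv : HasDerivAt (fun z : ℂ => 1 / z + h z) (-(z ^ 2)⁻¹ + deriv h z) z := by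
    simpa only [one_div] using (hasDerivAt_inv hz).fun_add h₃.differentiableAt.hasDerivAt
  rw [h₁, h₂, hinv.deriv, hkh z hz]
  field_simp
  ring

/-- There is no elliptic function whose only poles are simple poles at the lattice points. -/
lemma not_exists_simple_pole {φ h : ℂ → ℂ} (hφ : ∀ z ∉ P.lattice, AnalyticAt ℂ φ z)
    (hper : ∀ l ∈ P.lattice, ∀ z ∉ P.lattice, φ (z + l) = φ z)
    (hh : AnalyticAt ℂ h 0) (hφh : ∀ᶠ z in 𝓝[≠] 0, φ z = 1 / z + h z) : False := by
  wlog h0 : h 0 = 0 generalizing φ h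
  · refine this (φ := fun z => φ z - h 0) (h := fun z => h z - h 0)
      (fun z hz => (hφ z hz).sub analyticAt_const) (fun l hl z hz => by rw [hper l hl z hz])
      (hh.sub analyticAt_const) ?_ (sub_self _)
    filter_upwards [hφh] with z hz
    rw [hz]
    ring
  have hperd (l) (hl : l ∈ P.lattice) (z) (hz : z ∉ P.lattice) :
      deriv φ (z + l) = deriv φ z := by
    rw [← deriv_comp_add_const]
    refine EventuallyEq.deriv_eq ?_
    filter_upwards [P.isOpen_compl_lattice.mem_nhds hz] with w hw using hper l hl w hw
  obtain ⟨C, hC⟩ := P.exists_eqOn_const (F := fun z => φ z ^ 2 + deriv φ z)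
    (fun z hz => ((hφ z hz).pow 2).add (hφ z hz).deriv)
    (extAnalyticAt_sq_add_deriv hh h0 hφh)
    (fun l hl z hz => by rw [hper l hl z hz, hperd l hl z hz])
  obtain ⟨c, hc⟩ := IsAlgClosed.exists_pow_nat_eq C (n := 2) two_pos
  rw [← hc] at hC
  have hne {z : ℂ} (hz : z ∉ P.lattice) : φ z - c ≠ 0 :=
    sub_ne_zero.2 (P.ne_of_riccati hφ hh hφh hC hz)
  have hq : AnalyticAt ℂ (fun z => z / (1 + z * (h z - c))) 0 :=
    analyticAt_id.div (by fun_prop) (by simp)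
  have hvq : ∀ᶠ z in 𝓝[≠] 0, (φ z - c)⁻¹ = z / (1 + z * (h z - c)) := by
    filter_upwards [hφh, self_mem_nhdsWithin] with z hz (hne : z ≠ 0)
    rw [hz, show 1 / z + h z - c = (1 + z * (h z - c)) / z by field_simp; ring, inv_div]
  obtain ⟨K, hK⟩ := P.exists_eqOn_const (F := fun z => (φ z - c)⁻¹)
    (fun z hz => ((hφ z hz).sub analyticAt_const).inv (hne hz)) ⟨_, hq, hvq⟩
    (fun l hl z hz => by rw [hper l hl z hz])
  have hK0 : K = 0 := by
    refine tendsto_nhds_unique_of_eventuallyEq (l := 𝓝[≠] (0 : ℂ)) tendsto_const_nhds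
      (by simpa using hq.continuousAt.tendsto.mono_left nhdsWithin_le_nhds) ?_
    filter_upwards [hvq, P.eventually_notMem_lattice 0] with z h₁ h₂
    rw [← h₁, hK z h₂]
  have := hK _ P.ω₁_div_two_notMem_lattice
  rw [hK0] at this
  exact inv_ne_zero (hne P.ω₁_div_two_notMem_lattice) this

end PeriodPair

/-! ### Linear combinations of translated zeta functions -/

lemma ExtAnalyticAt.of_hasPrincPart {f g : ℂ → ℂ} {α : ℂ} {c : ℕ →₀ ℂ} (hf : HasPrincPart f α c)
    (hg : HasPrincPart g α c) : ExtAnalyticAt (fun z => f z - g z) α := by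
  refine (ExtAnalyticAt.sub hf hg).congr (.of_forall fun z => ?_)
  ring

lemma meromorphicAt_laurentTail (α z : ℂ) (c : ℕ →₀ ℂ) : MeromorphicAt (laurentTail α c) z := by
  induction c using Finsupp.induction_linear with
  | zero => rw [map_zero]; exact MeromorphicAt.const 0 z
  | add c d hc hd => simpa using hc.add hd
  | single k a =>
    refine MeromorphicAt.congr (f := fun z => a * (1 / (z - α) ^ (k + 1))) (by fun_prop)
      (.of_forall fun z => (laurentTail_single α k a z).symm)

lemma HasPrincPart.meromorphicAt {f : ℂ → ℂ} {α : ℂ} {c : ℕ →₀ ℂ} (h : HasPrincPart f α c) :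
    MeromorphicAt f α :=
  ((ExtAnalyticAt.meromorphicAt h).fun_add (meromorphicAt_laurentTail α α c)).congr
    (.of_forall fun z => by simp)

namespace PeriodPair

variable (P : PeriodPair) {I : Type*} (pt : I → ℂ)

/-- The linear combination of translated zeta functions with principal parts `D.curry i`
at `pt i`. -/
noncomputable def zetaSum : (I × ℕ →₀ ℂ) →ₗ[ℂ] (ℂ → ℂ) :=
  Finsupp.linearCombination ℂ fun q z => P.zetaPart q.2 (z - pt q.1)

/-- The sum of the residues. -/
noncomputable def residueSum : (I × ℕ →₀ ℂ) →ₗ[ℂ] ℂ :=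
  Finsupp.linearCombination ℂ fun q => if q.2 = 0 then 1 else 0

lemma zetaSum_single (q : I × ℕ) (a z : ℂ) :
    P.zetaSum pt (Finsupp.single q a) z = a * P.zetaPart q.2 (z - pt q.1) := by
  simp [zetaSum]

lemma residueSum_single (q : I × ℕ) (a : ℂ) :
    residueSum (Finsupp.single q a) = if q.2 = 0 then a else 0 := by
  simp [residueSum]

variable {pt}

lemma hasPrincPart_zetaSum (hpt : ∀ z, ∃! i, z - pt i ∈ P.lattice) (D : I × ℕ →₀ ℂ) (i : I)
    {l : ℂ} (hl : l ∈ P.lattice) : HasPrincPart (P.zetaSum pt D) (pt i + l) (D.curry i) := by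
  classical
  induction D using Finsupp.induction_linear with
  | zero =>
    have : (0 : I × ℕ →₀ ℂ).curry i = 0 := by ext; simp [Finsupp.curry_apply]
    rw [this, map_zero]
    exact analyticAt_const.hasPrincPart
  | add C D hC hD =>
    have : (C + D).curry i = C.curry i + D.curry i := by ext; simp [Finsupp.curry_apply]
    rw [this, map_add]
    exact hC.add hD
  | single q a =>
    obtain ⟨j, k⟩ := q
    by_cases hij : j = i
    · subst hij
      have : (Finsupp.single (j, k) a).curry j = a • Finsupp.single k 1 := by
        ext m
        simp [Finsupp.single_apply]
      rw [this]
      have h : HasPrincPart (fun z => P.zetaPart k (z + -pt j)) (pt j + l) (Finsupp.single k 1) :=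
        HasPrincPart.comp_add_right (by simpa using P.hasPrincPart_zetaPart k hl)
      refine (h.const_mul a).congr (.of_forall fun z => ?_)
      rw [zetaSum_single, sub_eq_add_neg]
    · have : (Finsupp.single (j, k) a).curry i = 0 := by
        ext m
        simp [hij]
      rw [this]
      have hj : pt i + l - pt j ∉ P.lattice := fun h =>
        hij ((hpt (pt i + l)).unique h (by simpa using hl))
      refine HasPrincPart.congr (f := fun z => a * P.zetaPart k (z - pt j))
        (AnalyticAt.hasPrincPart (analyticAt_const.mul ?_))
        (.of_forall fun z => P.zetaSum_single pt _ _ _)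
      exact (P.analyticAt_zetaPart k hj).comp_of_eq
        (g := P.zetaPart k) (f := fun z => z - pt j) (by fun_prop) rfl

lemma meromorphicOn_zetaSum (hpt : ∀ z, ∃! i, z - pt i ∈ P.lattice) (D : I × ℕ →₀ ℂ) :
    MeromorphicOn (P.zetaSum pt D) univ := by
  intro α _
  obtain ⟨i, hi, -⟩ := hpt α
  have h := P.hasPrincPart_zetaSum hpt D i hi
  rw [add_sub_cancel] at h
  exact h.meromorphicAt

lemma eventually_zetaSum_add (D : I × ℕ →₀ ℂ) {l η : ℂ}
    (hη : ∀ k, ∀ z ∉ P.lattice,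
      P.zetaPart k (z + l) = P.zetaPart k z + if k = 0 then η else 0) :
    ∀ᶠ z in codiscrete ℂ, P.zetaSum pt D (z + l) = P.zetaSum pt D z + residueSum D * η := by
  induction D using Finsupp.induction_linear with
  | zero => simp
  | add C D hC hD =>
    filter_upwards [hC, hD] with z h₁ h₂
    simp only [map_add, Pi.add_apply, h₁, h₂]
    ring
  | single q a =>
    filter_upwards [(tendsto_add_right_codiscrete (-pt q.1)).eventually
      P.eventually_notMem_lattice_codiscrete] with z hz
    have := hη q.2 _ hz
    rw [zetaSum_single, zetaSum_single, residueSum_single, sub_eq_add_neg, sub_eq_add_neg,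
      add_right_comm, this]
    split_ifs <;> ring

/-! ### The decomposition of an elliptic function -/

lemma exists_isCompact_forall_exists_add_mem :
    ∃ K : Set ℂ, IsCompact K ∧ ∀ z, ∃ l ∈ P.lattice, z + l ∈ K := by
  refine ⟨closure (ZSpan.fundamentalDomain P.basis),
    (ZSpan.fundamentalDomain_isBounded P.basis).isCompact_closure, fun z => ?_⟩
  obtain ⟨v, hv, -⟩ := ZSpan.exist_unique_vadd_mem_fundamentalDomain P.basis z
  refine ⟨v, ?_, subset_closure ?_⟩
  · rw [P.lattice_eq_span_range_basis]
    exact v.2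
  · rw [add_comm]
    exact hv

variable {P} in
lemma _root_.IsElliptic.analyticAt_add {g : ℂ → ℂ} (hg : IsElliptic P.lattice g) {z l : ℂ}
    (hl : l ∈ P.lattice) (hz : AnalyticAt ℂ g z) : AnalyticAt ℂ g (z + l) := by
  have h : AnalyticAt ℂ (fun w => g (w - l)) (z + l) :=
    hz.comp_of_eq (g := g) (f := fun w => w - l) (by fun_prop) (by simp)
  refine h.congr ?_
  have : Tendsto (fun w => w - l) (𝓝 (z + l)) (𝓝 z) := by
    simpa using (continuous_sub_right l).tendsto (z + l)
  filter_upwards [this.eventually hz.eventually_analyticAt] with w hw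
  simpa using (hg.2 l hl _ hw).symm

variable {P} in
lemma _root_.IsElliptic.finite_not_analyticAt {g : ℂ → ℂ} (hg : IsElliptic P.lattice g)
    (hpt : ∀ z, ∃! i, z - pt i ∈ P.lattice) : {i | ¬AnalyticAt ℂ g (pt i)}.Finite := by
  obtain ⟨K, hK, hex⟩ := P.exists_isCompact_forall_exists_add_mem
  choose l hl hlK using hex
  have hfin : (K \ {z | AnalyticAt ℂ g z}).Finite :=
    hK.finite_sdiff_of_mem_codiscreteWithin
      (codiscreteWithin_mono (subset_univ K) (eventually_analyticAt_codiscrete hg.1))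
  refine Set.Finite.of_finite_image (f := fun i => pt i + l (pt i)) (hfin.subset ?_) ?_
  · rintro _ ⟨i, hi, rfl⟩
    refine ⟨hlK _, fun h => hi ?_⟩
    simpa using hg.analyticAt_add (neg_mem (hl (pt i))) h
  · intro i _ j _ (hij : pt i + l (pt i) = pt j + l (pt j))
    refine (hpt (pt i + l (pt i))).unique (by simpa using hl (pt i)) ?_
    rw [hij]
    simpa using hl (pt j)

variable {P} in
lemma _root_.IsElliptic.exists_curry {g : ℂ → ℂ} (hg : IsElliptic P.lattice g)
    (hpt : ∀ z, ∃! i, z - pt i ∈ P.lattice) :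
    ∃ C : I × ℕ →₀ ℂ, ∀ i, HasPrincPart g (pt i) (C.curry i) := by
  choose d hd using fun i => (hg.1 (pt i) trivial).exists_hasPrincPart
  have hfin : (Function.support d).Finite := by
    refine (hg.finite_not_analyticAt hpt).subset fun i hi ha => hi ?_
    exact (hd i).unique ha.hasPrincPart
  refine ⟨(Finsupp.ofSupportFinite d hfin).uncurry, fun i => ?_⟩
  convert hd i
  ext k
  rw [Finsupp.curry_apply, Finsupp.uncurry_apply, Finsupp.ofSupportFinite_coe]

variable {P} in
lemma _root_.IsElliptic.eventually_add {g : ℂ → ℂ} (hg : IsElliptic P.lattice g) {l : ℂ}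
    (hl : l ∈ P.lattice) : ∀ᶠ z in codiscrete ℂ, g (z + l) = g z := by
  filter_upwards [eventually_analyticAt_codiscrete hg.1] with z hz using hg.2 l hl z hz

variable {P} in
lemma _root_.IsElliptic.hasPrincPart_add {g : ℂ → ℂ} (hg : IsElliptic P.lattice g) {α l : ℂ}
    {c : ℕ →₀ ℂ} (hl : l ∈ P.lattice) (hc : HasPrincPart g α c) : HasPrincPart g (α + l) c := by
  have h : HasPrincPart (fun z => g (z + -l)) (α + l) c :=
    HasPrincPart.comp_add_right (by simpa using hc)
  exact h.congr ((eventually_codiscrete_iff.1 (hg.eventually_add (neg_mem hl)) _).mono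
    fun z hz => hz.symm)

lemma eq_const_of_quasiperiodic {H : ℂ → ℂ} (hH : Differentiable ℂ H) (ρ : ℂ)
    (hper : ∀ l ∈ P.lattice, ∀ η, (∀ z ∉ P.lattice,
      wzeta P.lattice (z + l) = wzeta P.lattice z + η) → ∀ z, H (z + l) = H z - ρ * η) :
    ρ = 0 ∧ ∀ z, H z = H 0 := by
  obtain ⟨a, ha⟩ : ∃ a, ∀ z, deriv H z = a := by
    refine ⟨deriv H 0, fun z => hH.deriv.eq_const_of_periodic P (fun z l hl => ?_) z 0⟩
    obtain ⟨η, hη⟩ := P.exists_wzeta_add_eq hl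
    rw [← deriv_comp_add_const, funext (hper l hl η hη), deriv_sub_const]
  have hlin (z) : H z = a * z + H 0 := by
    have := is_const_of_deriv_eq_zero (f := fun z => H z - a * z) (by fun_prop) (fun z => by
      have := ((hH z).hasDerivAt.fun_sub ((hasDerivAt_id z).const_mul a)).deriv
      simpa [ha] using this) z 0
    simp only [mul_zero, sub_zero] at this
    rw [← this]
    ring
  have hmul {l η : ℂ} (hl : l ∈ P.lattice) (hη : ∀ z ∉ P.lattice,
      wzeta P.lattice (z + l) = wzeta P.lattice z + η) : a * l = -(ρ * η) := by
    have := hper l hl η hη 0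
    rw [hlin] at this
    linear_combination this
  have hρ : ρ = 0 := by
    by_contra hρ
    obtain ⟨h, hh, he⟩ := P.exists_wzeta_eq_add P.lattice.zero_mem
    refine P.not_exists_simple_pole (φ := fun z => wzeta P.lattice z + a / ρ * z)
      (h := fun z => h z + a / ρ * z)
      (fun z hz => (P.analyticAt_wzeta hz).add (by fun_prop)) (fun l hl z hz => ?_)
      (by fun_prop) (.of_forall fun z => ?_)
    · obtain ⟨η, hη⟩ := P.exists_wzeta_add_eq hl
      rw [hη z hz]
      field_simp
      linear_combination hmul hl hη
    · simp only [he z, sub_zero]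
      ring
  refine ⟨hρ, fun z => ?_⟩
  obtain ⟨η, hη⟩ := P.exists_wzeta_add_eq P.ω₁_mem_lattice
  have h0 := hmul P.ω₁_mem_lattice hη
  have hω : P.ω₁ ≠ 0 := fun h => P.ω₁_div_two_notMem_lattice (by simp [h])
  rw [hρ, zero_mul, neg_zero, mul_eq_zero, or_iff_left hω] at h0
  rw [hlin, h0, zero_mul, zero_add]

variable {P} in
lemma _root_.IsElliptic.exists_eq_const_add_zetaSum {g : ℂ → ℂ} (hg : IsElliptic P.lattice g)
    (hpt : ∀ z, ∃! i, z - pt i ∈ P.lattice) {C : I × ℕ →₀ ℂ}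
    (hC : ∀ i, HasPrincPart g (pt i) (C.curry i)) :
    residueSum C = 0 ∧ ∃ b, ∀ᶠ z in codiscrete ℂ, g z = b + P.zetaSum pt C z := by
  have hext (α : ℂ) : ExtAnalyticAt (fun z => g z - P.zetaSum pt C z) α := by
    obtain ⟨i, hi, -⟩ := hpt α
    have := ExtAnalyticAt.of_hasPrincPart (hg.hasPrincPart_add hi (hC i))
      (P.hasPrincPart_zetaSum hpt C i hi)
    rwa [add_sub_cancel] at this
  obtain ⟨H, hH, hgH⟩ := exists_differentiable_of_extAnalyticAt hext
  obtain ⟨hres, hconst⟩ := P.eq_const_of_quasiperiodic hH (residueSum C) fun l hl η hη z => by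
    obtain ⟨η', hη'⟩ := P.exists_zetaPart_add_eq hl
    obtain rfl : η' = η := by
      have h₁ := hη' 0 _ P.ω₁_div_two_notMem_lattice
      have h₂ := hη _ P.ω₁_div_two_notMem_lattice
      rw [if_pos rfl, zetaPart_zero, zetaPart_zero, h₂] at h₁
      exact (add_left_cancel h₁).symm
    refine congrFun (eq_of_continuous_of_eventuallyEq_codiscrete (F := fun z => H (z + l))
      (G := fun z => H z - residueSum C * η') (hH.continuous.comp (by fun_prop))
      (by have := hH.continuous; fun_prop) ?_) z
    filter_upwards [hgH, (tendsto_add_right_codiscrete l).eventually hgH, hg.eventually_add hl,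
      P.eventually_zetaSum_add C hη'] with w h₁ h₂ h₃ h₄
    rw [← h₁, ← h₂, h₃, h₄]
    ring
  refine ⟨hres, H 0, ?_⟩
  filter_upwards [hgH] with z hz
  rw [← hconst z, ← hz]
  ring

/-- Sums of zeta functions with different principal parts do not differ by a constant. -/
lemma zetaSum_injective (hpt : ∀ z, ∃! i, z - pt i ∈ P.lattice) {C D : I × ℕ →₀ ℂ} {b : ℂ}
    (h : ∀ᶠ z in codiscrete ℂ, P.zetaSum pt C z = b + P.zetaSum pt D z) : C = D ∧ b = 0 := by
  have hCD : C = D := by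
    ext ⟨i, k⟩
    have h₁ := P.hasPrincPart_zetaSum hpt C i P.lattice.zero_mem
    have h₂ := (analyticAt_const (v := b)).hasPrincPart.add
      (P.hasPrincPart_zetaSum hpt D i P.lattice.zero_mem)
    have := DFunLike.congr_fun (h₁.unique (h₂.congr (eventually_codiscrete_iff.1 h _))) k
    simpa [Finsupp.curry_apply] using this
  obtain ⟨z, hz⟩ := h.exists
  refine ⟨hCD, ?_⟩
  simpa [hCD] using hz

end PeriodPair

/-! ### Linear algebra of the shift -/

lemma finsum_finsum_finsum_eq_linearCombination {ι κ μ : Type*} (D : (ι × κ) × μ →₀ ℂ)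
    (F : (ι × κ) × μ → ℂ) :
    (∑ᶠ r, ∑ᶠ n, ∑ᶠ k, D ((r, n), k) * F ((r, n), k)) = Finsupp.linearCombination ℂ F D := by
  have hfin : (Function.support fun q => D q * F q).Finite :=
    D.hasFiniteSupport.subset (Function.support_mul_subset_left _ _)
  have hfin' : (Function.support fun p : ι × κ => ∑ᶠ k, D (p, k) * F (p, k)).Finite := by
    refine (hfin.image Prod.fst).subset fun p hp => ?_
    obtain ⟨k, hk⟩ : ∃ k, D (p, k) * F (p, k) ≠ 0 := by
      by_contra! h
      simp [h] at hp
    exact ⟨(p, k), hk, rfl⟩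
  rw [← finsum_curry (fun p : ι × κ => ∑ᶠ k, D (p, k) * F (p, k)) hfin',
    ← finsum_curry (fun q => D q * F q) hfin, Finsupp.linearCombination_apply, Finsupp.sum,
    finsum_eq_sum_of_support_subset (s := D.support)]
  · simp
  · simp

section Shift

variable {ι : Type*}

/-- The effect on principal parts of translating a function by `s`. -/
noncomputable def shift : ((ι × ℤ) × ℕ →₀ ℂ) →ₗ[ℂ] ((ι × ℤ) × ℕ →₀ ℂ) :=
  Finsupp.lmapDomain ℂ ℂ fun q => ((q.1.1, q.1.2 - 1), q.2)

/-- The panorbital residue. -/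
noncomputable def panResidue : ((ι × ℤ) × ℕ →₀ ℂ) →ₗ[ℂ] ℂ :=
  Finsupp.linearCombination ℂ fun q => if q.2 = 0 then (q.1.2 : ℂ) else 0

/-- The orbital residues. -/
noncomputable def orbResidue : ((ι × ℤ) × ℕ →₀ ℂ) →ₗ[ℂ] (ι × ℕ →₀ ℂ) :=
  Finsupp.lmapDomain ℂ ℂ fun q => (q.1.1, q.2)

lemma shift_single (r : ι) (n : ℤ) (k : ℕ) (a : ℂ) :
    shift (Finsupp.single ((r, n), k) a) = Finsupp.single ((r, n - 1), k) a := by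
  simp [shift]

lemma panResidue_shift (D : (ι × ℤ) × ℕ →₀ ℂ) :
    panResidue (shift D) = panResidue D - PeriodPair.residueSum D := by
  induction D using Finsupp.induction_linear with
  | zero => simp
  | add C D hC hD =>
    simp only [map_add, hC, hD]
    ring
  | single q a =>
    rw [shift_single, PeriodPair.residueSum_single]
    simp only [panResidue, Finsupp.linearCombination_single, smul_eq_mul]
    split_ifs <;> push_cast <;> ring

lemma orbResidue_shift (D : (ι × ℤ) × ℕ →₀ ℂ) : orbResidue (shift D) = orbResidue D := by
  rw [orbResidue, shift, ← LinearMap.comp_apply, ← Finsupp.lmapDomain_comp]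
  rfl

lemma exists_eq_shift_sub (D : (ι × ℤ) × ℕ →₀ ℂ) (hD : orbResidue D = 0) :
    ∃ C, D = shift C - C := by
  let W := LinearMap.range (shift (ι := ι) - LinearMap.id)
  have hstep (r : ι) (n : ℤ) (k : ℕ) (a : ℂ) :
      Finsupp.single ((r, n - 1), k) a - Finsupp.single ((r, n), k) a ∈ W :=
    ⟨Finsupp.single ((r, n), k) a, by simp [shift_single]⟩
  let base : (ι × ℕ →₀ ℂ) →ₗ[ℂ] ((ι × ℤ) × ℕ →₀ ℂ) :=
    Finsupp.lmapDomain ℂ ℂ fun q => ((q.1, 0), q.2)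
  have hbase (D) : D - base (orbResidue D) ∈ W := by
    induction D using Finsupp.induction_linear with
    | zero => simp
    | add C D hC hD => simpa [add_sub_add_comm] using W.add_mem hC hD
    | single q a =>
      obtain ⟨⟨r, n⟩, k⟩ := q
      have : base (orbResidue (Finsupp.single ((r, n), k) a)) = Finsupp.single ((r, 0), k) a := by
        simp [base, orbResidue]
      rw [this]
      clear this
      induction n using Int.induction_on with
      | zero => simp
      | succ n ih => simpa using W.sub_mem ih (hstep r (n + 1) k a)
      | pred n ih => simpa using W.add_mem ih (hstep r (-n) k a)
  obtain ⟨C, hC⟩ := hbase D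
  refine ⟨C, ?_⟩
  simpa [hD] using hC.symm

lemma orbResidue_apply (D : (ι × ℤ) × ℕ →₀ ℂ) (r : ι) (k : ℕ) :
    orbResidue D (r, k) = ∑ᶠ n, D ((r, n), k) := by
  have hfin (D : (ι × ℤ) × ℕ →₀ ℂ) : (Function.support fun n => D ((r, n), k)).Finite :=
    D.hasFiniteSupport.preimage (f := fun n => ((r, n), k)) (fun a _ b _ hab => by simpa using hab)
  induction D using Finsupp.induction_linear with
  | zero => simp
  | add C D hC hD =>
    rw [map_add, Finsupp.add_apply, hC, hD, ← finsum_add_distrib (hfin C) (hfin D)]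
    rfl
  | single q a =>
    obtain ⟨⟨r', n'⟩, k'⟩ := q
    rw [finsum_eq_single _ n' fun n hn => by simp [hn.symm]]
    classical simp [orbResidue, Finsupp.single_apply]

lemma panResidue_apply (D : (ι × ℤ) × ℕ →₀ ℂ) :
    panResidue D = ∑ᶠ r, ∑ᶠ n : ℤ, (n : ℂ) * D ((r, n), 0) := by
  rw [panResidue, ← finsum_finsum_finsum_eq_linearCombination]
  refine finsum_congr fun r => finsum_congr fun n => ?_
  rw [finsum_eq_single _ 0 fun k hk => by simp [hk]]
  simp [mul_comm]

lemma PeriodPair.zetaSum_shift (P : PeriodPair) {pt : ι × ℤ → ℂ} {s : ℂ}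
    (hpt : ∀ r n, pt (r, n - 1) = pt (r, n) - s) (D : (ι × ℤ) × ℕ →₀ ℂ) (z : ℂ) :
    P.zetaSum pt (shift D) z = P.zetaSum pt D (z + s) := by
  induction D using Finsupp.induction_linear with
  | zero => simp
  | add C D hC hD => simp [hC, hD]
  | single q a =>
    obtain ⟨⟨r, n⟩, k⟩ := q
    rw [shift_single, zetaSum_single, zetaSum_single, hpt, sub_sub_eq_add_sub]

end Shift

/-- It suffices to check summability off a discrete set. -/
lemma ellSummable_of_eventually (P : PeriodPair) {f g : ℂ → ℂ} {s : ℂ}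
    (hf : IsElliptic P.lattice f) (hg : MeromorphicOn g univ)
    (hper : ∀ l ∈ P.lattice, ∀ᶠ z in codiscrete ℂ, g (z + l) = g z)
    (hfg : ∀ᶠ z in codiscrete ℂ, f z = g (z + s) - g z) : EllSummable P.lattice s f := by
  -- The indicator makes `G` discontinuous where `f` is not analytic.
  let G (z : ℂ) : ℂ := limUnder (𝓝[≠] z) g + {z | ¬AnalyticAt ℂ f z}.indicator 1 z
  have hGg : ∀ᶠ z in codiscrete ℂ, G z = g z := by
    filter_upwards [eventually_analyticAt_codiscrete hg, eventually_analyticAt_codiscrete hf.1]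
      with z hgz hfz
    simp only [G]
    rw [(hgz.continuousAt.tendsto.mono_left nhdsWithin_le_nhds).limUnder_eq,
      Set.indicator_of_notMem (by simpa using hfz), add_zero]
  have htend {z : ℂ} (hz : AnalyticAt ℂ G z) : Tendsto g (𝓝[≠] z) (𝓝 (G z)) :=
    (hz.continuousAt.tendsto.mono_left nhdsWithin_le_nhds).congr'
      (eventually_codiscrete_iff.1 hGg z)
  have hfan {z : ℂ} (hz : AnalyticAt ℂ G z) : AnalyticAt ℂ f z := by
    by_contra hfz
    have h₁ : G z = limUnder (𝓝[≠] z) g + {z | ¬AnalyticAt ℂ f z}.indicator 1 z := rfl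
    rw [(htend hz).limUnder_eq, Set.indicator_of_mem (by simpa using hfz)] at h₁
    simp at h₁
  refine ⟨G, ⟨fun z _ => (hg z trivial).congr ?_, fun l hl z hz => ?_⟩, fun z hz hzs => ?_⟩
  · exact (eventually_codiscrete_iff.1 hGg z).mono fun w hw => hw.symm
  · have h₁ : Tendsto g (𝓝[≠] (z + l)) (𝓝 (G z)) := by
      have h₂ : Tendsto (fun w => w + -l) (𝓝[≠] (z + l)) (𝓝[≠] z) := by
        simpa using tendsto_add_right_nhdsNE (z + l) (-l)
      exact ((htend hz).comp h₂).congr'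
        (eventually_codiscrete_iff.1 (hper (-l) (neg_mem hl)) (z + l))
    have h₃ : AnalyticAt ℂ f (z + l) := hf.analyticAt_add hl (hfan hz)
    change limUnder (𝓝[≠] (z + l)) g + {z | ¬AnalyticAt ℂ f z}.indicator 1 (z + l) = _
    rw [h₁.limUnder_eq, Set.indicator_of_notMem (by simpa using h₃), add_zero]
  · exact tendsto_nhds_unique_of_eventuallyEq
      ((hfan hz).continuousAt.tendsto.mono_left nhdsWithin_le_nhds)
      (((htend hzs).comp (tendsto_add_right_nhdsNE z s)).sub (htend hz))
      (eventually_codiscrete_iff.1 hfg z)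

lemma IsLattice.exists_periodPair {L : Set ℂ} (hL : IsLattice L) :
    ∃ P : PeriodPair, L = P.lattice := by
  obtain ⟨ω₁, ω₂, hind, rfl⟩ := hL
  refine ⟨⟨ω₁, ω₂, hind⟩, ?_⟩
  ext z
  simp only [mem_ofPred_eq, SetLike.mem_coe, PeriodPair.mem_lattice, eq_comm]

lemma IsPinning.existsUnique {L : Submodule ℤ ℂ} {s : ℂ} {R : Set ℂ} (hR : IsPinning L s R)
    (z : ℂ) : ∃! i : R × ℤ, z - (i.1 + i.2 * s) ∈ L := by
  obtain ⟨⟨r, n, l⟩, ⟨hr, hl, hz⟩, huniq⟩ := hR z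
  refine ⟨(⟨r, hr⟩, n), by simpa [hz] using hl, ?_⟩
  rintro ⟨⟨r', hr'⟩, n'⟩ h
  have := huniq (r', n', z - (r' + n' * s)) ⟨hr', h, by simp⟩
  simp only [Prod.mk.injEq] at this
  simp [this.1, this.2.1]

lemma PeriodPair.zetaSum_apply (P : PeriodPair) {I : Type*} (pt : I → ℂ) (D : I × ℕ →₀ ℂ)
    (z : ℂ) : P.zetaSum pt D z =
      Finsupp.linearCombination ℂ (fun q => P.zetaPart q.2 (z - pt q.1)) D := by
  simp [zetaSum, Finsupp.linearCombination_apply, Finsupp.sum, Finset.sum_apply]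

theorem stmt2 (L : Set ℂ) (hL : IsLattice L) (s : ℂ)
    (hs : ∀ n : ℕ, 1 ≤ n → (n : ℂ) * s ∉ L)
    (R : Set ℂ) (hR : IsPinning L s R)
    (f : ℂ → ℂ) (hf : IsElliptic L f)
    (c : ℂ → ℕ → ℂ) (hc : ∀ α : ℂ, IsPrincPart f α (c α))
    (c₀ : ℂ)
    (hc₀ : ∀ z : ℂ, AnalyticAt ℂ f z →
      f z = c₀ + ∑ᶠ r ∈ R, ∑ᶠ n : ℤ, ∑ᶠ k : ℕ,
        ((-1 : ℂ) ^ (k - 1) * c (r + (n : ℂ) * s) k / (Nat.factorial (k - 1) : ℂ)) *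
          iteratedDeriv (k - 1) (wzeta L) (z - r - (n : ℂ) * s)) :
    EllSummable L s f ↔
      (c₀ = 0 ∧
        (∑ᶠ r ∈ R, ∑ᶠ n : ℤ, (n : ℂ) * c (r + (n : ℂ) * s) 1) = 0 ∧
        ∀ r ∈ R, ∀ k : ℕ, 1 ≤ k → (∑ᶠ n : ℤ, c (r + (n : ℂ) * s) k) = 0) := by
  obtain ⟨P, rfl⟩ := hL.exists_periodPair
  let pt : R × ℤ → ℂ := fun i => i.1 + i.2 * s
  have hpt : ∀ z, ∃! i, z - pt i ∈ P.lattice := hR.existsUnique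
  have hshift (r n) : pt (r, n - 1) = pt (r, n) - s := by
    simp only [pt]
    push_cast
    ring
  obtain ⟨C, hC⟩ := hf.exists_curry hpt
  have hCc (r : R) (n : ℤ) (k : ℕ) : C ((r, n), k) = c (r + n * s) (k + 1) := by
    obtain ⟨d, hd, hfd⟩ := (hc (r + n * s)).hasPrincPart
    rw [← hd, ← (hC (r, n)).unique hfd, Finsupp.curry_apply]
  have hfC : ∀ᶠ z in codiscrete ℂ, f z = c₀ + P.zetaSum pt C z := by
    filter_upwards [eventually_analyticAt_codiscrete hf.1] with z hz
    rw [hc₀ z hz, P.zetaSum_apply, ← finsum_finsum_finsum_eq_linearCombination,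
      ← finsum_subtype_eq_finsum_cond (· ∈ R)]
    congr 1
    refine finsum_congr fun r => finsum_congr fun n => ?_
    rw [finsum_nat_eq_finsum_succ (by simp [(hc _).1])]
    refine finsum_congr fun k => ?_
    simp only [hCc, PeriodPair.zetaPart, pt, add_tsub_cancel_right, sub_sub]
    ring
  have hpan : (∑ᶠ r ∈ R, ∑ᶠ n : ℤ, (n : ℂ) * c (r + (n : ℂ) * s) 1) = panResidue C := by
    simp only [panResidue_apply, hCc, zero_add]
    exact (finsum_subtype_eq_finsum_cond (· ∈ R)).symm
  have horb (r : R) (k : ℕ) :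
      (∑ᶠ n : ℤ, c (r + (n : ℂ) * s) (k + 1)) = orbResidue C (r, k) := by
    simp only [orbResidue_apply, hCc]
  rw [hpan]
  constructor
  · rintro ⟨g, hg, hfg⟩
    obtain ⟨D, hD⟩ := hg.exists_curry hpt
    obtain ⟨hres, b, hgD⟩ := hg.exists_eq_const_add_zetaSum hpt hD
    have hg_an := eventually_analyticAt_codiscrete hg.1
    have hsum : ∀ᶠ z in codiscrete ℂ, P.zetaSum pt (shift D - D) z = c₀ + P.zetaSum pt C z := by
      filter_upwards [hfC, hgD, (tendsto_add_right_codiscrete s).eventually hgD, hg_an,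
        (tendsto_add_right_codiscrete s).eventually hg_an] with z h₁ h₂ h₃ h₄ h₅
      rw [← h₁, hfg z h₄ h₅, h₂, h₃, map_sub, Pi.sub_apply, P.zetaSum_shift hshift]
      ring
    obtain ⟨rfl, rfl⟩ := P.zetaSum_injective hpt hsum
    refine ⟨rfl, by simp [panResidue_shift, hres], fun r hr k hk => ?_⟩
    obtain ⟨k, rfl⟩ := Nat.exists_eq_add_of_le' hk
    rw [horb ⟨r, hr⟩ k, map_sub, orbResidue_shift, sub_self, Finsupp.zero_apply]
  · rintro ⟨rfl, hpan0, horb0⟩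
    obtain ⟨D, rfl⟩ := exists_eq_shift_sub C (by
      ext ⟨r, k⟩
      rw [← horb, horb0 r r.2 (k + 1) le_add_self, Finsupp.zero_apply])
    have hres : PeriodPair.residueSum D = 0 := by
      simpa [panResidue_shift] using hpan0
    refine ellSummable_of_eventually P hf (P.meromorphicOn_zetaSum hpt D) (fun l hl => ?_) ?_
    · obtain ⟨η, hη⟩ := P.exists_zetaPart_add_eq hl
      simpa [hres] using P.eventually_zetaSum_add (pt := pt) D hη
    · filter_upwards [hfC] with z hz
      rw [hz, zero_add, map_sub, Pi.sub_apply, P.zetaSum_shift hshift]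
end

section
/- Let Λ ⊆ ℂ be a lattice and let s ∈ ℂ satisfy ns ∉ Λ for every integer n ≥ 1. For every n ∈ ℤ, the function Ψ_n(z) := −ζ_Λ(z−ns) + n·ζ_Λ(z−s) − (n−1)·ζ_Λ(z) is an elliptic function for Λ and is elliptically summable. -/
open Filter Topology Set

/-- The summand of the Weierstrass zeta function at the lattice point `l`; with the convention
`1 / 0 = 0` it equals `1 / z` for `l = 0`. -/
noncomputable def wzetaTerm (l z : ℂ) : ℂ := 1 / (z - l) + 1 / l + z / l ^ 2

lemma norm_wzetaTerm_le {r : ℝ} (hr : 0 < r) {z l : ℂ} (hz : ‖z‖ < r) (h : 2 * r ≤ ‖l‖) :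
    ‖wzetaTerm l z‖ ≤ 2 * r ^ 2 * ‖l‖ ^ (-3 : ℝ) := by
  have hl : 0 < ‖l‖ := by linarith
  have hl0 : l ≠ 0 := norm_pos_iff.mp hl
  have hzl : ‖l‖ / 2 ≤ ‖z - l‖ := by
    rw [norm_sub_rev]
    exact .trans (by linarith) (norm_sub_norm_le l z)
  have hzl0 : z - l ≠ 0 := norm_pos_iff.mp (by linarith)
  have key : wzetaTerm l z = z ^ 2 / ((z - l) * l ^ 2) := by
    unfold wzetaTerm
    field_simp
    ring
  calc ‖wzetaTerm l z‖ = ‖z‖ ^ 2 / (‖z - l‖ * ‖l‖ ^ 2) := by rw [key]; simp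
    _ ≤ r ^ 2 / (‖l‖ / 2 * ‖l‖ ^ 2) := by gcongr
    _ = 2 * r ^ 2 / ‖l‖ ^ 3 := by field
    _ = _ := by norm_cast

lemma wzetaTerm_neg (l z : ℂ) : wzetaTerm (-l) (-z) = -wzetaTerm l z := by
  have h : -z - -l = -(z - l) := by ring
  simp only [wzetaTerm, h, div_neg, neg_sq, neg_div]
  ring

lemma meromorphicAt_wzetaTerm (l x : ℂ) : MeromorphicAt (wzetaTerm l) x := by
  unfold wzetaTerm
  fun_prop

namespace PeriodPair

variable (L : PeriodPair)

lemma hasSumLocallyUniformly_wzetaTerm_except (l₀ : ℂ) :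
    HasSumLocallyUniformly (fun (l : L.lattice) (z : ℂ) ↦ if l.1 = l₀ then 0 else wzetaTerm l z)
      (fun z ↦ ∑' l : L.lattice, if l.1 = l₀ then 0 else wzetaTerm l z) := by
  refine L.hasSumLocallyUniformly_aux (u := fun r l ↦ 2 * r ^ 2 * ‖l‖ ^ (-3 : ℝ)) _
    (fun _ _ ↦ (ZLattice.summable_norm_rpow _ _ (by simp; norm_num)).mul_left _) fun r hr ↦
    Filter.eventually_atTop.mpr ⟨2 * r, ?_⟩
  rintro _ h z hz l rfl
  split_ifs
  · rw [norm_zero]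
    positivity
  · exact norm_wzetaTerm_le hr hz h

lemma summable_wzetaTerm (z : ℂ) : Summable fun l : L.lattice ↦ wzetaTerm l z := by
  convert (L.hasSumLocallyUniformly_wzetaTerm_except (L.ω₁ / 2)).hasSum (x := z) |>.summable
    using 2 with l
  rw [if_neg]
  exact fun e ↦ L.ω₁_div_two_notMem_lattice (e ▸ l.2)

lemma differentiableOn_tsum_wzetaTerm_except (l₀ : ℂ) :
    DifferentiableOn ℂ (fun z ↦ ∑' l : L.lattice, if l.1 = l₀ then 0 else wzetaTerm l z)
      (L.lattice \ {l₀})ᶜ := by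
  refine (L.hasSumLocallyUniformly_wzetaTerm_except l₀).hasSumLocallyUniformlyOn.differentiableOn
    (.of_forall fun s ↦ .fun_sum fun i _ ↦ ?_) L.isOpen_compl_lattice_sdiff
  split_ifs
  · simp
  · unfold wzetaTerm
    refine .add (.add (.div (by fun_prop) (by fun_prop) fun x hx ↦ ?_) (by fun_prop)) (by fun_prop)
    have : x ≠ i := by rintro rfl; simp_all
    simpa [sub_eq_zero]

lemma wzeta_eq_tsum_s6 (z : ℂ) : wzeta L.lattice z = ∑' l : L.lattice, wzetaTerm l z := by
  rw [(L.summable_wzetaTerm z).tsum_eq_add_tsum_ite 0, wzeta]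
  congr 1
  · simp [wzetaTerm]
  · have h1 := tsum_subtype ((L.lattice : Set ℂ) \ {0}) (fun l ↦ wzetaTerm l z)
    have h2 := tsum_subtype (L.lattice : Set ℂ) (fun l ↦ if l = 0 then 0 else wzetaTerm l z)
    refine h1.trans (.trans ?_ (h2.symm.trans ?_))
    · refine tsum_congr fun l ↦ ?_
      classical
      by_cases hl : l = 0 <;> simp [Set.indicator_apply, hl]
    · refine tsum_congr fun l ↦ ?_
      simp

lemma meromorphic_wzeta : Meromorphic (wzeta L.lattice) := by
  intro x
  have hE : MeromorphicAt
      (fun z ↦ ∑' l : L.lattice, if l.1 = x then 0 else wzetaTerm l z) x :=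
    ((L.differentiableOn_tsum_wzetaTerm_except x).analyticAt
      (L.compl_lattice_sdiff_singleton_mem_nhds x)).meromorphicAt
  rw [show wzeta L.lattice = fun z ↦ ∑' l : L.lattice, wzetaTerm l z from
    funext L.wzeta_eq_tsum_s6]
  by_cases hx : x ∈ L.lattice
  · convert (meromorphicAt_wzetaTerm x x).add hE using 1
    ext z
    rw [(L.summable_wzetaTerm z).tsum_eq_add_tsum_ite ⟨x, hx⟩]
    simp [Subtype.ext_iff]
  · convert hE using 4 with z l
    rw [if_neg]
    exact fun e ↦ hx (e ▸ l.2)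

lemma wzeta_neg (z : ℂ) : wzeta L.lattice (-z) = -wzeta L.lattice z := by
  simp only [wzeta_eq_tsum_s6]
  rw [← (Equiv.neg L.lattice).tsum_eq, ← tsum_neg]
  simp [wzetaTerm_neg]

lemma hasSum_wzeta_add_sub (l₀ : L.lattice) (z : ℂ) :
    HasSum (fun l : L.lattice ↦ 1 / (l : ℂ) + (z + l₀) / (l : ℂ) ^ 2
        - (1 / ((l : ℂ) - l₀) + z / ((l : ℂ) - l₀) ^ 2))
      (wzeta L.lattice (z + l₀) - wzeta L.lattice z) := by
  have h1 := (L.summable_wzetaTerm (z + l₀)).hasSum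
  have h2 := (Equiv.subRight l₀).hasSum_iff.mpr (L.summable_wzetaTerm z).hasSum
  rw [wzeta_eq_tsum_s6, wzeta_eq_tsum_s6]
  refine (h1.sub h2).congr_fun fun l ↦ ?_
  have : z + (l₀ : ℂ) - l = z - (l - l₀) := by ring
  simp only [wzetaTerm, Function.comp_apply, Equiv.subRight_apply, AddSubgroupClass.coe_sub, this]
  ring

/-- Quasi-periodicity of the zeta function. It holds at the poles too, because the values assigned
there by `1 / 0 = 0` are compatible with translation. -/
lemma wzeta_add_sub_eq (l₀ : L.lattice) (z : ℂ) :
    wzeta L.lattice (z + l₀) - wzeta L.lattice z = wzeta L.lattice l₀ - wzeta L.lattice 0 := by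
  set D : ℂ → ℂ := fun z ↦ wzeta L.lattice (z + l₀) - wzeta L.lattice z with hD
  have hadd (z w : ℂ) : D z + D w = D (z + w) + D 0 := by
    refine ((L.hasSum_wzeta_add_sub l₀ z).add (L.hasSum_wzeta_add_sub l₀ w)).unique ?_
    convert (L.hasSum_wzeta_add_sub l₀ (z + w)).add (L.hasSum_wzeta_add_sub l₀ 0) using 2 with l
    ring
  have hneg (z : ℂ) : D (-z - l₀) = D z := by
    simp only [hD]
    rw [sub_add_cancel, ← neg_add', wzeta_neg, wzeta_neg]
    ring
  have h0 : D z = D 0 := by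
    have h1 := hadd z (-z - l₀)
    have h2 := hadd 0 (-0 - l₀)
    rw [hneg, show z + (-z - (l₀ : ℂ)) = 0 + (-0 - l₀) by ring] at h1
    rw [hneg] at h2
    linear_combination (h1 - h2) / 2
  simpa [hD] using h0

lemma wzeta_sub_wzeta_add (l₀ : L.lattice) (z w : ℂ) :
    wzeta L.lattice (z + l₀) - wzeta L.lattice (w + l₀)
      = wzeta L.lattice z - wzeta L.lattice w := by
  linear_combination L.wzeta_add_sub_eq l₀ z - L.wzeta_add_sub_eq l₀ w

lemma exists_add_sub_eq_wzeta_combination (s : ℂ) (n : ℤ) :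
    ∃ g : ℂ → ℂ, Meromorphic g ∧ (∀ l : L.lattice, ∀ z, g (z + l) = g z) ∧
      ∀ z, -wzeta L.lattice (z - n * s) + n * wzeta L.lattice (z - s)
        - (n - 1) * wzeta L.lattice z = g (z + s) - g z := by
  have hm (c : ℂ) : Meromorphic fun z ↦ wzeta L.lattice (z - c) :=
    Meromorphic.meromorphic_fun_comp_sub_const_iff_meromorphic.mpr L.meromorphic_wzeta
  have hp (l : L.lattice) (c d z : ℂ) :
      wzeta L.lattice (z + l - c) - wzeta L.lattice (z + l - d)
        = wzeta L.lattice (z - c) - wzeta L.lattice (z - d) := by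
    rw [← L.wzeta_sub_wzeta_add l (z - c), sub_add_eq_add_sub, sub_add_eq_add_sub]
  have hshift (k : ℤ) (z : ℂ) : z + s - (k + 1) * s = z - k * s := by ring
  induction n using Int.induction_on with
  | zero => exact ⟨fun _ ↦ 0, .const 0, by simp, by simp⟩
  | succ k ih =>
    obtain ⟨g, hg, hper, hsum⟩ := ih
    refine ⟨fun z ↦ g z + (wzeta L.lattice (z - (k + 1) * s) - wzeta L.lattice (z - s)),
      hg.fun_add ((hm _).fun_sub (hm _)), fun l z ↦ ?_, fun z ↦ ?_⟩
    · simp only [hper, hp]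
    · have h := hshift k z
      have h' := hsum z
      push_cast at h h' ⊢
      simp only [h, add_sub_cancel_right]
      linear_combination h'
  | pred k ih =>
    obtain ⟨g, hg, hper, hsum⟩ := ih
    refine ⟨fun z ↦ g z - (wzeta L.lattice (z - (-k : ℤ) * s) - wzeta L.lattice (z - s)),
      hg.fun_sub ((hm _).fun_sub (hm _)), fun l z ↦ ?_, fun z ↦ ?_⟩
    · simp only [hper, hp]
    · have h := hshift (-k - 1) z
      have h' := hsum z
      push_cast at h h' ⊢
      simp only [sub_add_cancel] at h
      simp only [h, add_sub_cancel_right]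
      linear_combination h'

end PeriodPair

theorem stmt6 (L : Set ℂ) (hL : IsLattice L) (s : ℂ)
    (hs : ∀ n : ℕ, 1 ≤ n → (n : ℂ) * s ∉ L) (n : ℤ) :
    IsElliptic L (fun z => -wzeta L (z - (n : ℂ) * s) + (n : ℂ) * wzeta L (z - s)
      - ((n : ℂ) - 1) * wzeta L z) ∧
    EllSummable L s (fun z => -wzeta L (z - (n : ℂ) * s) + (n : ℂ) * wzeta L (z - s)
      - ((n : ℂ) - 1) * wzeta L z) := by
  obtain ⟨P, rfl⟩ := hL.exists_periodPair
  obtain ⟨g, hg, hper, hsum⟩ := P.exists_add_sub_eq_wzeta_combination s n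
  have hgs : Meromorphic fun z ↦ g (z + s) := by
    simpa using (Meromorphic.meromorphic_fun_comp_sub_const_iff_meromorphic (c := -s)).mpr hg
  refine ⟨⟨?_, fun l hl z _ ↦ ?_⟩, g, ⟨fun z _ ↦ hg z, fun l hl z _ ↦ hper ⟨l, hl⟩ z⟩,
    fun z _ _ ↦ hsum z⟩
  · rw [funext hsum]
    exact fun z _ ↦ (hgs.fun_sub hg) z
  · have h (w : ℂ) : g (w + l) = g w := hper ⟨l, hl⟩ w
    simp only [hsum, h, add_right_comm z l s]
end
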